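/- Let L, L_r, L_s, Σ, Q be a normed continuous-time Markov game structure, fix t ∈ ℝ and 0 < ε ≤ 1, and let x : L → ℝ satisfy x(l) ∈ [0,1] for all l. Let p1 be a single ε-net approximation from x with chosen actions a_l, and let g1 : L → ℝ → ℝ satisfy g1(l,t) = x(l), take values in [0,1] on [t−ε,t], and for every τ ∈ [t−ε,t]: for l ∈ L_r the derivative of g1(l,·) at τ equals −Σ_{l'} Q(l,a_l,l')·g1(l',τ), and for l ∈ L_s it equals −min over a ∈ Σ(l) of Σ_{l'} Q(l,a,l')·g1(l',τ). Then ‖g1(·, t−ε) − p1(·, t−ε)‖ ≤ ε², where ‖·‖ is the sup-norm over locations. -/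

import Mathlib

/-- A normed continuous-time Markov game structure: a finite nonempty set `L` of
locations partitioned into reachability locations (`isReach l = true`) and safety
locations (`isReach l = false`), a finite set `A` of actions with a nonempty set
`enabled l` of enabled actions at each location, and a rate matrix `R` whose rows
(for enabled actions) are probability distributions on `L`. -/
structure NCTMG (L A : Type) [Fintype L] [DecidableEq L] [Fintype A] where
  isReach : L → Bool
  enabled : L → Finset A
  enabled_nonempty : ∀ l, (enabled l).Nonempty
  R : L → A → L → ℝ
  R_nonneg : ∀ l a l', a ∈ enabled l → 0 ≤ R l a l'
  R_sum : ∀ l a, a ∈ enabled l → (∑ l', R l a l') = 1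

namespace NCTMG

variable {L A : Type} [Fintype L] [DecidableEq L] [Fintype A]

/-- The generator `Q(l,a,l') = R(l,a,l') − δ_{l,l'}`. -/
def Q (M : NCTMG L A) (l : L) (a : A) (l' : L) : ℝ :=
  M.R l a l' - (if l = l' then 1 else 0)

/-- `opt_l`: maximum over enabled actions at reachability locations, minimum
over enabled actions at safety locations. -/
noncomputable def opt (M : NCTMG L A) (l : L) (v : A → ℝ) : ℝ :=
  if M.isReach l then (M.enabled l).sup' (M.enabled_nonempty l) v
  else (M.enabled l).inf' (M.enabled_nonempty l) v

/-- `f` solves the Bellman equations on `[t−ε, t]` with terminal value `x`. -/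
def SolvesBellman (M : NCTMG L A) (t ε : ℝ) (x : L → ℝ) (f : L → ℝ → ℝ) : Prop :=
  (∀ l, f l t = x l) ∧
  ∀ l, ∀ τ ∈ Set.Icc (t - ε) t,
    HasDerivAt (f l) (-(M.opt l (fun a => ∑ l', M.Q l a l' * f l' τ))) τ

/-- `p1` is a single `ε`-net approximation from terminal value `x` with chosen
actions `act`: each `act l` is enabled and attains `opt_l` of `∑ Q(l,a,·)·x`,
and `p1(l, t−τ) = x(l) + τ·c_l` on `[0,ε]` where `c_l = ∑ Q(l,act l,·)·x`. -/
def IsSingleNet (M : NCTMG L A) (t ε : ℝ) (x : L → ℝ) (act : L → A)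
    (p1 : L → ℝ → ℝ) : Prop :=
  (∀ l, act l ∈ M.enabled l) ∧
  (∀ l, (∑ l', M.Q l (act l) l' * x l') =
      M.opt l (fun a => ∑ l', M.Q l a l' * x l')) ∧
  (∀ l, ∀ τ ∈ Set.Icc (0 : ℝ) ε,
      p1 l (t - τ) = x l + τ * (∑ l', M.Q l (act l) l' * x l'))

end NCTMG

/-- The sup-norm `‖v‖ = max_{l∈L} |v l|` on functions `L → ℝ`. -/
noncomputable def supNorm {L : Type} [Fintype L] [Nonempty L] (v : L → ℝ) : ℝ :=
  Finset.univ.sup' Finset.univ_nonempty (fun l => |v l|)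


namespace NCTMG

variable {L A : Type} [Fintype L] [DecidableEq L] [Fintype A]

theorem sum_Q_mul (M : NCTMG L A) (l : L) (a : A) (v : L → ℝ) :
    ∑ l', M.Q l a l' * v l' = (∑ l', M.R l a l' * v l') - v l := by
  simp [Q, sub_mul, Finset.sum_sub_distrib]

theorem sum_R_mul_le (M : NCTMG L A) {l : L} {a : A} (ha : a ∈ M.enabled l) {v : L → ℝ}
    {c : ℝ} (hv : ∀ l', v l' ≤ c) : ∑ l', M.R l a l' * v l' ≤ c := by
  calc ∑ l', M.R l a l' * v l' ≤ ∑ l', M.R l a l' * c :=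
        Finset.sum_le_sum fun l' _ => mul_le_mul_of_nonneg_left (hv l') (M.R_nonneg l a l' ha)
    _ = c := by rw [← Finset.sum_mul, M.R_sum l a ha, one_mul]

theorem le_sum_R_mul (M : NCTMG L A) {l : L} {a : A} (ha : a ∈ M.enabled l) {v : L → ℝ}
    {c : ℝ} (hv : ∀ l', c ≤ v l') : c ≤ ∑ l', M.R l a l' * v l' := by
  have h := M.sum_R_mul_le ha (v := fun l' => -v l') (c := -c) fun l' => neg_le_neg (hv l')
  simp only [mul_neg, Finset.sum_neg_distrib] at h
  linarith

theorem abs_sum_Q_mul_le_one (M : NCTMG L A) {l : L} {a : A} (ha : a ∈ M.enabled l)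
    {v : L → ℝ} (hv : ∀ l', v l' ∈ Set.Icc (0 : ℝ) 1) : |∑ l', M.Q l a l' * v l'| ≤ 1 := by
  have h1 := M.sum_R_mul_le ha fun l' => (hv l').2
  have h2 := M.le_sum_R_mul ha fun l' => (hv l').1
  obtain ⟨h3, h4⟩ := hv l
  rw [sum_Q_mul, abs_le]
  constructor <;> linarith

theorem abs_sum_Q_mul_sub_le (M : NCTMG L A) {l : L} {a : A} (ha : a ∈ M.enabled l)
    {v w : L → ℝ} {c : ℝ} (hvw : ∀ l', |v l' - w l'| ≤ c) :
    |∑ l', M.Q l a l' * v l' - ∑ l', M.Q l a l' * w l'| ≤ 2 * c := by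
  have h1 := M.sum_R_mul_le ha fun l' => (abs_le.1 (hvw l')).2
  have h2 := M.le_sum_R_mul ha fun l' => (abs_le.1 (hvw l')).1
  obtain ⟨h3, h4⟩ := abs_le.1 (hvw l)
  rw [← Finset.sum_sub_distrib]
  simp only [← mul_sub]
  rw [M.sum_Q_mul l a fun l' => v l' - w l', abs_le]
  constructor <;> linarith

/-- The drift at `l` when the reachability player is fixed to `act` and the safety player
minimises. -/
noncomputable def fixedDrift (M : NCTMG L A) (act : L → A) (l : L) (v : L → ℝ) : ℝ :=
  if M.isReach l then ∑ l', M.Q l (act l) l' * v l'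
  else (M.enabled l).inf' (M.enabled_nonempty l) fun a => ∑ l', M.Q l a l' * v l'

theorem abs_fixedDrift_le_one (M : NCTMG L A) {act : L → A} (l : L)
    (hact : act l ∈ M.enabled l) {v : L → ℝ} (hv : ∀ l', v l' ∈ Set.Icc (0 : ℝ) 1) :
    |M.fixedDrift act l v| ≤ 1 := by
  unfold fixedDrift
  split_ifs
  · exact M.abs_sum_Q_mul_le_one hact hv
  · obtain ⟨a, ha, h⟩ := Finset.exists_mem_eq_inf' (M.enabled_nonempty l)
      fun a => ∑ l', M.Q l a l' * v l'
    rw [h]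
    exact M.abs_sum_Q_mul_le_one ha hv

theorem abs_fixedDrift_sub_le (M : NCTMG L A) {act : L → A} (l : L)
    (hact : act l ∈ M.enabled l) {v w : L → ℝ} {c : ℝ} (hvw : ∀ l', |v l' - w l'| ≤ c) :
    |M.fixedDrift act l v - M.fixedDrift act l w| ≤ 2 * c := by
  have inf_sub_le {v w : L → ℝ} (hvw : ∀ l', |v l' - w l'| ≤ c) :
      (M.enabled l).inf' (M.enabled_nonempty l) (fun a => ∑ l', M.Q l a l' * v l') -
        (M.enabled l).inf' (M.enabled_nonempty l) (fun a => ∑ l', M.Q l a l' * w l') ≤ 2 * c := by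
    obtain ⟨a, ha, h⟩ := Finset.exists_mem_eq_inf' (M.enabled_nonempty l)
      fun a => ∑ l', M.Q l a l' * w l'
    rw [h]
    exact (sub_le_sub_right (Finset.inf'_le _ ha) _).trans
      (abs_le.1 (M.abs_sum_Q_mul_sub_le ha hvw)).2
  unfold fixedDrift
  split_ifs
  · exact M.abs_sum_Q_mul_sub_le hact hvw
  · exact abs_sub_le_iff.2 ⟨inf_sub_le hvw, inf_sub_le fun l' => abs_sub_comm (v l') _ ▸ hvw l'⟩

theorem fixedDrift_eq_of_opt (M : NCTMG L A) {act : L → A} {l : L} {x : L → ℝ}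
    (h : ∑ l', M.Q l (act l) l' * x l' = M.opt l fun a => ∑ l', M.Q l a l' * x l') :
    M.fixedDrift act l x = ∑ l', M.Q l (act l) l' * x l' := by
  unfold fixedDrift
  split_ifs with hl
  · rfl
  · rw [h, opt, if_neg hl]

end NCTMG

theorem abs_le_of_hasDerivAt_of_abs_deriv_le {f f' B B' : ℝ → ℝ} {b : ℝ}
    (hf : ∀ s ∈ Set.Icc 0 b, HasDerivAt f (f' s) s) (h0 : |f 0| ≤ B 0)
    (hB : ∀ s, HasDerivAt B (B' s) s) (bound : ∀ s ∈ Set.Icc 0 b, |f' s| ≤ B' s) :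
    ∀ s ∈ Set.Icc 0 b, |f s| ≤ B s :=
  fun _ hs => image_norm_le_of_norm_deriv_right_le_deriv_boundary
    (fun s hs => (hf s hs).continuousAt.continuousWithinAt)
    (fun s hs => (hf s (Set.Ico_subset_Icc_self hs)).hasDerivWithinAt) h0 hB
    (fun s hs => bound s (Set.Ico_subset_Icc_self hs)) hs

/-- the value `g1` obtained when the reachability player plays the
fixed single-net actions throughout `[t−ε,t]` (against an optimally playing
safety player) differs from the single ε-net approximation `p1` by at most `ε²`
at time `t−ε`. -/
theorem single_net_strategy_vs_p1 {L A : Type} [Fintype L] [DecidableEq L]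
    [Nonempty L] [Fintype A] (M : NCTMG L A) (t ε : ℝ) (hε0 : 0 < ε)
    (hε1 : ε ≤ 1)
    (x : L → ℝ) (hx : ∀ l, x l ∈ Set.Icc (0 : ℝ) 1)
    (act : L → A) (p1 : L → ℝ → ℝ) (hp1 : M.IsSingleNet t ε x act p1)
    (g1 : L → ℝ → ℝ)
    (hg1t : ∀ l, g1 l t = x l)
    (hg101 : ∀ l, ∀ τ ∈ Set.Icc (t - ε) t, g1 l τ ∈ Set.Icc (0 : ℝ) 1)
    (hg1r : ∀ l, M.isReach l = true → ∀ τ ∈ Set.Icc (t - ε) t,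
      HasDerivAt (g1 l) (-(∑ l', M.Q l (act l) l' * g1 l' τ)) τ)
    (hg1s : ∀ l, M.isReach l = false → ∀ τ ∈ Set.Icc (t - ε) t,
      HasDerivAt (g1 l)
        (-((M.enabled l).inf' (M.enabled_nonempty l)
            (fun a => ∑ l', M.Q l a l' * g1 l' τ))) τ) :
    supNorm (fun l => g1 l (t - ε) - p1 l (t - ε)) ≤ ε ^ 2 := by
  obtain ⟨hact, hopt, hp⟩ := hp1
  have hmem : ∀ s ∈ Set.Icc 0 ε, t - s ∈ Set.Icc (t - ε) t := fun s hs =>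
    ⟨by linarith [hs.2], by linarith [hs.1]⟩
  have hderiv : ∀ l, ∀ s ∈ Set.Icc 0 ε, HasDerivAt (fun s => g1 l (t - s))
      (M.fixedDrift act l fun l' => g1 l' (t - s)) s := by
    intro l s hs
    have h : HasDerivAt (g1 l) (-(M.fixedDrift act l fun l' => g1 l' (t - s))) (t - s) := by
      unfold NCTMG.fixedDrift
      split_ifs with hl
      · exact hg1r l hl _ (hmem s hs)
      · exact hg1s l (by simpa using hl) _ (hmem s hs)
    simpa using HasDerivAt.comp_const_sub t s h
  have hnear : ∀ l, ∀ s ∈ Set.Icc 0 ε, |g1 l (t - s) - x l| ≤ s := by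
    intro l
    exact abs_le_of_hasDerivAt_of_abs_deriv_le (B := fun s => s) (B' := fun _ => 1)
      (fun s hs => (hderiv l s hs).sub_const (x l)) (by simp [hg1t]) (fun s => hasDerivAt_id s)
      (fun s hs => M.abs_fixedDrift_le_one l (hact l) fun l' => hg101 l' _ (hmem s hs))
  have herr : ∀ l, ∀ s ∈ Set.Icc 0 ε,
      |g1 l (t - s) - (x l + s * M.fixedDrift act l x)| ≤ s ^ 2 := by
    intro l
    refine abs_le_of_hasDerivAt_of_abs_deriv_le (B := fun s => s ^ 2) (B' := fun s => 2 * s)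
      (f' := fun s => (M.fixedDrift act l fun l' => g1 l' (t - s)) - M.fixedDrift act l x)
      (fun s hs => (hderiv l s hs).sub ?_) (by simp [hg1t])
      (fun s => by simpa using hasDerivAt_pow 2 s)
      (fun s hs => M.abs_fixedDrift_sub_le l (hact l) fun l' => hnear l' s hs)
    simpa using ((hasDerivAt_id s).mul_const (M.fixedDrift act l x)).const_add (x l)
  refine Finset.sup'_le _ _ fun l _ => ?_
  have hε : ε ∈ Set.Icc 0 ε := ⟨hε0.le, le_rfl⟩
  have h := herr l ε hε
  rwa [M.fixedDrift_eq_of_opt (hopt l), ← hp l ε hε] at h
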